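/- arXiv:1802.07702 — 2 statements merged into one kernel-verified Lean document; each statement's English description precedes it below -/
import Mathlib

section
/- Let f ∈ ℕ^{2n} be a partial switching flow (with respect to the origin o) and let r be a partial run profile of the run from o to d with r componentwise at most f; set δ = f − r. For any vertex u ∈ V, if exactly one of δ_{(u,s0(u))} and δ_{(u,s1(u))} is nonzero, then that nonzero value equals 1 and the corresponding edge belongs to the graph of last-used edges G*_f. -/
/-- One step of the train process: from a configuration (position, current switch
settings), the train moves along the current switch edge of its position and that
switch flips. `false` stands for the switch `s0`, `true` for `s1`. -/
def trainStep {V : Type} [DecidableEq V] (s : Bool → V → V) (st : V × (V → Bool)) :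
    V × (V → Bool) :=
  (s (st.2 st.1) st.1, Function.update st.2 st.1 (!(st.2 st.1)))

/-- Configuration (position, switch settings) of the run of the train from `o` to `d`
after `k` steps; the train starts at `o` with all switches set to `s0` and the process
stops when the train first reaches `d`. -/
def runState {V : Type} [DecidableEq V] (s : Bool → V → V) (o d : V) : ℕ → V × (V → Bool)
  | 0 => (o, fun _ => false)
  | k + 1 =>
      if (runState s o d k).1 = d then runState s o d k
      else trainStep s (runState s o d k)

/-- The partial run profile after `k` steps of the run of the train from `o` to `d`:
for each edge `(v, s b v)` (encoded by the pair `v`, `b`) the number of times the train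
has traversed it during the first `k` steps. -/
def runProfile {V : Type} [DecidableEq V] (s : Bool → V → V) (o d : V) : ℕ → V → Bool → ℕ
  | 0 => fun _ _ => 0
  | k + 1 =>
      if (runState s o d k).1 = d then runProfile s o d k
      else fun v b =>
        runProfile s o d k v b +
          if v = (runState s o d k).1 ∧ b = (runState s o d k).2 (runState s o d k).1
          then 1 else 0

/-- `f : V → Bool → ℕ` (where `f v b` is the value on the edge `(v, s b v)`) is a
switching flow from `o` to `v`: Kirchhoff's law and the parity condition hold. -/
def IsSwitchingFlow {V : Type} [Fintype V] [DecidableEq V] (s : Bool → V → V)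
    (o v : V) (f : V → Bool → ℕ) : Prop :=
  (∀ u : V,
      ((∑ w : V, ∑ b : Bool, if s b w = u then (f w b : ℤ) else 0)
          - ((f u false : ℤ) + (f u true : ℤ)))
        = (if u = v then 1 else 0) - (if u = o then 1 else 0)) ∧
  (∀ u : V, f u true ≤ f u false ∧ f u false ≤ f u true + 1)

/-- The edge `(v, s b v)` belongs to the graph of last-used edges `G*_f`. -/
def LastUsed {V : Type} (f : V → Bool → ℕ) (v : V) (b : Bool) : Prop :=
  (b = false ∧ f v false ≠ f v true) ∨ (b = true ∧ f v false = f v true ∧ 0 < f v true)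

/-- Adjacency of the graph of last-used edges `G*_f`. -/
def GstarAdj {V : Type} (s : Bool → V → V) (f : V → Bool → ℕ) (u w : V) : Prop :=
  ∃ b : Bool, LastUsed f u b ∧ s b u = w

/-- `c` is a directed cycle of the binary relation `adj`: a nonempty list of pairwise
distinct vertices with `adj` holding along the list cyclically. -/
def IsCycle {V : Type} (adj : V → V → Prop) (c : List V) : Prop :=
  c ≠ [] ∧ c.Nodup ∧
    ∀ i : Fin c.length, adj (c.get i) (c.get ⟨(i.1 + 1) % c.length, Nat.mod_lt _ i.pos⟩)

/-- The counts on the two edges out of `v` differ by one if the current switch at `v` is `s1`,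
and agree otherwise. -/
theorem runProfile_false_eq {V : Type} [DecidableEq V] (s : Bool → V → V) (o d : V) (k : ℕ)
    (v : V) :
    runProfile s o d k v false =
      runProfile s o d k v true + if (runState s o d k).2 v = true then 1 else 0 := by
  induction k with
  | zero => simp [runProfile, runState]
  | succ k ih =>
    by_cases hd : (runState s o d k).1 = d
    · simpa only [runProfile, runState, if_pos hd] using ih
    · simp only [runProfile, runState, if_neg hd, trainStep]
      by_cases hv : v = (runState s o d k).1
      · subst hv
        cases hb : (runState s o d k).2 (runState s o d k).1 <;> simp_all
      · simpa [hv] using ih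

/-- Let `f` be a partial switching flow (w.r.t. the origin `o`, with
end-vertex `vf`) and let `r = runProfile s o d k` be a partial run profile of the run
from `o` to `d` with `r` componentwise at most `f`. For any vertex `u`, if exactly one
of the two outgoing edges of `u` has `f - r` nonzero, then on that edge
`f = r + 1` and the edge belongs to the graph of last-used edges `G*_f`. -/
theorem single_nonzero_difference_is_last_used
    {V : Type} [Fintype V] [DecidableEq V] (s : Bool → V → V) (o d : V)
    (hd0 : s false d = d) (hd1 : s true d = d)
    (f : V → Bool → ℕ) (vf : V) (hf : IsSwitchingFlow s o vf f)
    (k : ℕ) (hle : ∀ v b, runProfile s o d k v b ≤ f v b) :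
    ∀ (u : V) (b : Bool),
      f u b ≠ runProfile s o d k u b →
      f u (!b) = runProfile s o d k u (!b) →
      f u b = runProfile s o d k u b + 1 ∧ LastUsed f u b := by
  intro u b hne heq
  have hparity := runProfile_false_eq s o d k u
  have hflow := hf.2 u
  have hlt := lt_of_le_of_ne (hle u b) hne.symm
  unfold LastUsed
  split_ifs at hparity <;> cases b <;> simp at * <;> omega
end

section
/- Let r be the partial run profile after R ≥ 1 steps of the run of the train from o to d. For each vertex x that the train has departed from at least once during the first R steps, let t_r(x) ∈ {0,…,R−1} denote the last step index at which the train moved out of x. Then for every edge (x,y) of the graph of last-used edges G*_r, except the edge traversed at step R−1 (the edge through which the train arrived at the end-vertex v_r), the train has departed from y at least once and t_r(x) < t_r(y). -/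
/-- The current switch at `v` is `s0` iff both edges out of `v` were used equally often;
otherwise `s0` was used once more than `s1`. -/
theorem runProfile_parity {V : Type} [DecidableEq V] (s : Bool → V → V) (o d : V)
    (n : ℕ) (v : V) :
    runProfile s o d n v false =
      runProfile s o d n v true + if (runState s o d n).2 v = true then 1 else 0 := by
  induction n with
  | zero => simp [runProfile, runState]
  | succ n ih =>
    by_cases hd : (runState s o d n).1 = d
    · simpa only [runProfile, runState, if_pos hd] using ih
    · simp only [runProfile, runState, if_neg hd, trainStep]
      by_cases hv : v = (runState s o d n).1
      · subst hv
        cases hb : (runState s o d n).2 (runState s o d n).1 <;> simp_all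
      · simp_all [Function.update_of_ne]

/-- A last-used edge is the one opposite to the current switch edge. -/
theorem LastUsed.eq_not_switch {V : Type} [DecidableEq V] {s : Bool → V → V} {o d : V}
    {n : ℕ} {v : V} {b : Bool} (hb : LastUsed (runProfile s o d n) v b) :
    b = !(runState s o d n).2 v := by
  have hp := runProfile_parity s o d n v
  rcases hb with ⟨rfl, hne⟩ | ⟨rfl, heq, -⟩
  · cases hs : (runState s o d n).2 v <;> simp_all
  · cases hs : (runState s o d n).2 v <;> simp_all

theorem runState_succ_of_ne {V : Type} [DecidableEq V] {s : Bool → V → V} {o d : V} {n : ℕ}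
    (hn : (runState s o d n).1 ≠ d) :
    runState s o d (n + 1) = trainStep s (runState s o d n) := by
  rw [runState, if_neg hn]

/-- Before a time at which the train is not at `d`, it has never been at `d`. -/
theorem runState_ne_of_le {V : Type} [DecidableEq V] {s : Bool → V → V} {o d : V} {m n : ℕ}
    (hmn : m ≤ n) (hn : (runState s o d n).1 ≠ d) : (runState s o d m).1 ≠ d := by
  intro hm
  apply hn
  induction n, hmn using Nat.le_induction with
  | base => exact hm
  | succ n _ ih =>
    by_contra hne
    have hnd : (runState s o d n).1 = d := by
      by_contra hc
      exact hc (ih hc)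
    rw [runState, if_pos hnd] at hne
    exact hne hnd

/-- The switch at a vertex does not change while the train does not depart from it. -/
theorem runState_switch_eq {V : Type} [DecidableEq V] {s : Bool → V → V} {o d v : V} {m n : ℕ}
    (hmn : m ≤ n) (hv : ∀ j, m ≤ j → j < n → (runState s o d j).1 ≠ v) :
    (runState s o d n).2 v = (runState s o d m).2 v := by
  induction n, hmn using Nat.le_induction with
  | base => rfl
  | succ n hmn ih =>
    rw [← ih fun j hj hjn => hv j hj (hjn.trans n.lt_succ_self), runState]
    split_ifs
    · rfl
    · exact Function.update_of_ne (hv n hmn n.lt_succ_self).symm _ _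

/-- Let `r` be the partial run profile after `R = k + 1 ≥ 1` steps of
the run of the train from `o` to `d` (the train actually makes its `R`-th step). For a
vertex `z`, a step index `j` is the last departure of the train from `z` within the
first `R` steps iff `j ≤ k`, the train is at `z` after `j` steps, `z ≠ d`, and no later
step index `j' ≤ k` has the train at `z`. Then for every edge `(x, s b x)` of `G*_r`
other than the edge traversed at step `R - 1` (the edge through which the train arrived
at the end-vertex), if `jx` is the last departure from `x`, then the train has departed
from `y = s b x` at least once, with last departure `jy` satisfying `jx < jy`. -/
theorem last_used_edges_increase_departure_times
    {V : Type} [Fintype V] [DecidableEq V] (s : Bool → V → V) (o d : V)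
    (hd0 : s false d = d) (hd1 : s true d = d)
    (k : ℕ) (h : (runState s o d k).1 ≠ d) :
    ∀ (x : V) (b : Bool),
      LastUsed (runProfile s o d (k + 1)) x b →
      ¬(x = (runState s o d k).1 ∧ b = (runState s o d k).2 (runState s o d k).1) →
      ∀ jx : ℕ,
        (jx ≤ k ∧ (runState s o d jx).1 = x ∧ x ≠ d ∧
          ∀ j' : ℕ, j' ≤ k → (runState s o d j').1 = x → j' ≤ jx) →
        ∃ jy : ℕ,
          (jy ≤ k ∧ (runState s o d jy).1 = s b x ∧ s b x ≠ d ∧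
            ∀ j' : ℕ, j' ≤ k → (runState s o d j').1 = s b x → j' ≤ jy) ∧
          jx < jy := by
  rintro x b hb hlast jx ⟨hjk, rfl, hxd, hmax⟩
  have hstep := runState_succ_of_ne hxd
  have hsw := runState_switch_eq (s := s) (o := o) (d := d) (v := (runState s o d jx).1)
    (Nat.succ_le_succ hjk) fun j hj hjn hjx => by
      have := hmax j (Nat.lt_succ_iff.mp hjn) hjx
      omega
  have hbx : b = (runState s o d jx).2 (runState s o d jx).1 := by
    rw [hb.eq_not_switch, hsw, hstep]
    simp [trainStep]
  have hpos : (runState s o d (jx + 1)).1 = s b (runState s o d jx).1 := by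
    rw [hstep, hbx, trainStep]
  have hlt : jx < k := by
    refine lt_of_le_of_ne hjk ?_
    rintro rfl
    exact hlast ⟨rfl, hbx⟩
  refine ⟨Nat.findGreatest (fun j => (runState s o d j).1 = s b (runState s o d jx).1) k,
    ⟨Nat.findGreatest_le k, ?_, ?_, fun j hj hjy => Nat.le_findGreatest hj hjy⟩,
    Nat.le_findGreatest (P := fun j => (runState s o d j).1 = s b (runState s o d jx).1)
      hlt hpos⟩
  · exact Nat.findGreatest_spec
      (P := fun j => (runState s o d j).1 = s b (runState s o d jx).1) hlt hpos
  · rw [← hpos]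
    exact runState_ne_of_le hlt h
end
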